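/- arXiv:2005.00671 — 2 statements merged into one kernel-verified Lean document; each statement's English description precedes it below -/
import Mathlib

section
/- Let G be a finite simple graph with μ(G) < ν(G), let (M, H, H') be a maximum intersection triple in G, and let P be a maximal M,H-alternating path in G of length at least 2. Then both end edges of P belong to H'. -/
open Finset

section Defs
variable {V : Type*}

/-- A matching: a set of edges, pairwise non-adjacent. -/
def IsMatchingSet (G : SimpleGraph V) (M : Finset (Sym2 V)) : Prop :=
  ↑M ⊆ G.edgeSet ∧ ∀ e ∈ M, ∀ f ∈ M, e ≠ f → ∀ v : V, v ∈ e → v ∉ f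

/-- A vertex is saturated by a matching if some edge of it is incident to the vertex. -/
def Saturates (M : Finset (Sym2 V)) (v : V) : Prop :=
  ∃ e ∈ M, v ∈ e

/-- ν(G): maximum size of a matching. -/
noncomputable def nuG (G : SimpleGraph V) : ℕ :=
  sSup {n | ∃ M : Finset (Sym2 V), IsMatchingSet G M ∧ M.card = n}

/-- λ(G): maximum of |H| + |H'| over pairs of disjoint matchings. -/
noncomputable def lamG (G : SimpleGraph V) : ℕ :=
  sSup {n | ∃ H H' : Finset (Sym2 V), IsMatchingSet G H ∧ IsMatchingSet G H' ∧
    Disjoint H H' ∧ H.card + H'.card = n}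

/-- Λ(G): set of pairs of disjoint matchings realizing λ(G). -/
def LambdaSet (G : SimpleGraph V) : Set (Finset (Sym2 V) × Finset (Sym2 V)) :=
  {p | IsMatchingSet G p.1 ∧ IsMatchingSet G p.2 ∧ Disjoint p.1 p.2 ∧
    p.1.card + p.2.card = lamG G}

/-- μ(G): maximum of |H| over pairs (H, H') ∈ Λ(G). -/
noncomputable def muG (G : SimpleGraph V) : ℕ :=
  sSup {n | ∃ p ∈ LambdaSet G, p.1.card = n}

/-- Λ_μ(G): pairs in Λ(G) with |H| = μ(G). -/
def LambdaMuSet (G : SimpleGraph V) : Set (Finset (Sym2 V) × Finset (Sym2 V)) :=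
  {p | p ∈ LambdaSet G ∧ p.1.card = muG G}

end Defs

/-- A maximum intersection triple: M a maximum matching, (H, H') ∈ Λ_μ(G),
|M ∩ (H ∪ H')| is maximized over all such choices, and subject to that,
|M ∩ H| is maximized. -/
def MaxIntersectionTriple {V : Type*} [DecidableEq V] (G : SimpleGraph V)
    (M H H' : Finset (Sym2 V)) : Prop :=
  IsMatchingSet G M ∧ M.card = nuG G ∧ (H, H') ∈ LambdaMuSet G ∧
  (∀ M₂ N₂ N₂' : Finset (Sym2 V), IsMatchingSet G M₂ → M₂.card = nuG G →
    (N₂, N₂') ∈ LambdaMuSet G →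
    (M₂ ∩ (N₂ ∪ N₂')).card ≤ (M ∩ (H ∪ H')).card) ∧
  (∀ M₂ N₂ N₂' : Finset (Sym2 V), IsMatchingSet G M₂ → M₂.card = nuG G →
    (N₂, N₂') ∈ LambdaMuSet G →
    (M₂ ∩ (N₂ ∪ N₂')).card = (M ∩ (H ∪ H')).card →
    (M₂ ∩ N₂).card ≤ (M ∩ H).card)

/-- A list of edges is A,B-alternating: its edges alternately belong to A ∖ B and
to B ∖ A (starting with either). -/
def AltEdges {V : Type*} [DecidableEq V] (A B : Finset (Sym2 V))
    (l : List (Sym2 V)) : Prop :=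
  (∀ (i : ℕ) (h : i < l.length),
    if Even i then l.get ⟨i, h⟩ ∈ A \ B else l.get ⟨i, h⟩ ∈ B \ A) ∨
  (∀ (i : ℕ) (h : i < l.length),
    if Even i then l.get ⟨i, h⟩ ∈ B \ A else l.get ⟨i, h⟩ ∈ A \ B)

/-- A maximal A,B-alternating path: an A,B-alternating path not properly contained
in a longer A,B-alternating path. -/
def IsMaxAltPath {V : Type*} [DecidableEq V] (G : SimpleGraph V)
    (A B : Finset (Sym2 V)) {u v : V} (p : G.Walk u v) : Prop :=
  p.IsPath ∧ AltEdges A B p.edges ∧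
  ¬ ∃ (u' v' : V) (q : G.Walk u' v'), q.IsPath ∧ AltEdges A B q.edges ∧
    (∀ e ∈ p.edges, e ∈ q.edges) ∧ p.edges.length < q.edges.length

namespace IsMatchingSet

variable {V : Type*} {G : SimpleGraph V} {M : Finset (Sym2 V)}

lemma eq_of_mem (hM : IsMatchingSet G M) {e f : Sym2 V} (he : e ∈ M) (hf : f ∈ M) {x : V}
    (hxe : x ∈ e) (hxf : x ∈ f) : e = f := by
  by_contra h
  exact hM.2 e he f hf h x hxe hxf

/-- Exchanging an edge `f` of a matching for an edge `e` all of whose neighbours in the matching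
equal `f` gives a matching. -/
lemma insert_erase [DecidableEq V] (hM : IsMatchingSet G M) {e f : Sym2 V} (he : e ∈ G.edgeSet)
    (h : ∀ g ∈ M, ∀ x ∈ e, x ∈ g → g = f) : IsMatchingSet G (insert e (M.erase f)) := by
  refine ⟨?_, ?_⟩
  · intro a ha
    simp only [coe_insert, coe_erase, Set.mem_insert_iff, Set.mem_sdiff, mem_coe] at ha
    rcases ha with rfl | ha
    · exact he
    · exact hM.1 ha.1
  · intro a ha b hb hab x hxa hxb
    rw [mem_insert, mem_erase] at ha hb
    rcases ha with rfl | ha <;> rcases hb with rfl | hb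
    · exact hab rfl
    · exact hb.1 (h b hb.2 x hxa hxb)
    · exact ha.1 (h a ha.2 x hxb hxa)
    · exact hab (hM.eq_of_mem ha.2 hb.2 hxa hxb)

/-- Flipping a matching `M` along a set `P` of edges of `M` and of another matching `H`
gives a matching when `P` contains every edge of `M` adjacent to an edge of `P` outside `M`. -/
lemma flip [DecidableEq V] {H P : Finset (Sym2 V)} (hM : IsMatchingSet G M)
    (hH : IsMatchingSet G H) (hP : ∀ e ∈ P, e ∉ M → e ∈ H)
    (hclosed : ∀ f ∈ P, f ∉ M → ∀ x ∈ f, ∀ e ∈ M, x ∈ e → e ∈ P) :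
    IsMatchingSet G ((M \ P) ∪ (P \ M)) := by
  refine ⟨?_, ?_⟩
  · intro a ha
    rw [mem_coe, mem_union, mem_sdiff, mem_sdiff] at ha
    rcases ha with ha | ha
    · exact hM.1 ha.1
    · exact hH.1 (hP a ha.1 ha.2)
  · intro a ha b hb hab x hxa hxb
    rw [mem_union, mem_sdiff, mem_sdiff] at ha hb
    rcases ha with ha | ha <;> rcases hb with hb | hb
    · exact hab (hM.eq_of_mem ha.1 hb.1 hxa hxb)
    · exact ha.2 (hclosed b hb.1 hb.2 x hxb a ha.1 hxa)
    · exact hb.2 (hclosed a ha.1 ha.2 x hxa b hb.1 hxb)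
    · exact hab (hH.eq_of_mem (hP a ha.1 ha.2) (hP b hb.1 hb.2) hxa hxb)

lemma card_le_nuG [Fintype V] (hM : IsMatchingSet G M) : M.card ≤ nuG G := by
  classical
  refine le_csSup ⟨Fintype.card (Sym2 V), ?_⟩ ⟨M, hM, rfl⟩
  rintro n ⟨N, -, rfl⟩
  exact N.card_le_univ

end IsMatchingSet

namespace MaxIntersectionTriple

variable {V : Type*} [DecidableEq V] {G : SimpleGraph V} {M H H' : Finset (Sym2 V)}

lemma isMatchingSet_left (ht : MaxIntersectionTriple G M H H') : IsMatchingSet G M := ht.1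

lemma isMatchingSet_right (ht : MaxIntersectionTriple G M H H') : IsMatchingSet G H :=
  ht.2.2.1.1.1

/-- A maximum intersection triple admits no flip of `M` towards `H` which does not decrease
the size of `M`. -/
lemma not_flip [Fintype V] (ht : MaxIntersectionTriple G M H H') {P : Finset (Sym2 V)}
    (hP : ∀ e ∈ P, e ∈ M \ H ∨ e ∈ H \ M)
    (hclosed : ∀ f ∈ P, f ∉ M → ∀ x ∈ f, ∀ e ∈ M, x ∈ e → e ∈ P)
    (hcard : (P ∩ M).card ≤ (P ∩ H).card) (hne : ∃ f ∈ P, f ∈ H) : False := by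
  have hPM : P \ M = P ∩ H := by
    ext e
    have := hP e
    simp only [mem_sdiff, mem_inter] at *
    tauto
  have hM' := ht.isMatchingSet_left.flip ht.isMatchingSet_right
    (fun e he h => by have := hP e he; simp only [mem_sdiff] at this; tauto) hclosed
  rw [hPM] at hM'
  obtain ⟨hM, hν, hΛ, hmax, hmax'⟩ := ht
  have hcard' : ((M \ P) ∪ (P ∩ H)).card + (P ∩ M).card = M.card + (P ∩ H).card := by
    rw [card_union_of_disjoint, inter_comm P M, ← card_sdiff_add_card_inter M P]
    · omega
    · rw [disjoint_left]
      intro a ha hb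
      exact (mem_sdiff.1 ha).2 (mem_inter.1 hb).1
  have hM'ν : ((M \ P) ∪ (P ∩ H)).card = nuG G := by
    have := hM'.card_le_nuG
    omega
  have hle : (M ∩ (H ∪ H')).card + (P ∩ H).card ≤
      (((M \ P) ∪ (P ∩ H)) ∩ (H ∪ H')).card + (P ∩ M).card := by
    rw [← card_union_of_disjoint]
    · refine (card_le_card ?_).trans (card_union_le _ _)
      intro e
      simp only [mem_union, mem_inter, mem_sdiff]
      tauto
    · rw [disjoint_left]
      intro a ha hb
      have := hP a (mem_inter.1 hb).1
      simp only [mem_sdiff, mem_inter] at *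
      tauto
  have heq := le_antisymm (hmax _ H H' hM' hM'ν hΛ) (by omega)
  have hlt : (M ∩ H).card < (((M \ P) ∪ (P ∩ H)) ∩ H).card := by
    apply card_lt_card
    rw [ssubset_iff_of_subset]
    · obtain ⟨f, hfP, hfH⟩ := hne
      refine ⟨f, by simp [hfP, hfH], ?_⟩
      have := hP f hfP
      simp only [mem_sdiff, mem_inter] at *
      tauto
    · intro e he
      have := hP e
      simp only [mem_union, mem_inter, mem_sdiff] at *
      tauto
  exact absurd (hmax' _ H H' hM' hM'ν hΛ heq) (by omega)

/-- An edge of `M` outside `H` all of whose neighbours in `H` equal a single edge outside `M`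
belongs to `H'`. -/
lemma mem_of_unique_neighbor (ht : MaxIntersectionTriple G M H H') {e f : Sym2 V} (heM : e ∈ M)
    (heH : e ∉ H) (hfH : f ∈ H) (hfM : f ∉ M) (h : ∀ g ∈ H, ∀ x ∈ e, x ∈ g → g = f) :
    e ∈ H' := by
  by_contra heH'
  have hN := ht.isMatchingSet_right.insert_erase (ht.isMatchingSet_left.1 heM) h
  obtain ⟨hM, hν, ⟨⟨hH, hH', hdisj, hlam⟩, hμ⟩, hmax, -⟩ := ht
  have hcard : (insert e (H.erase f)).card = H.card := by
    rw [card_insert_of_notMem (by simp [heH]), card_erase_add_one hfH]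
  have hlt : (M ∩ (H ∪ H')).card < (M ∩ (insert e (H.erase f) ∪ H')).card := by
    apply card_lt_card
    rw [ssubset_iff_of_subset]
    · exact ⟨e, by simp [heM], by simp [heH, heH']⟩
    · intro a ha
      have : a ∈ M → a ≠ f := fun ha => ne_of_mem_of_not_mem ha hfM
      simp only [mem_union, mem_inter, mem_insert, mem_erase] at *
      tauto
  refine absurd (hmax M _ H' hM hν ⟨⟨hN, hH', ?_, ?_⟩, ?_⟩) (by omega)
  · exact disjoint_insert_left.2 ⟨heH', hdisj.mono_left (erase_subset _ _)⟩
  · simp only [hcard, hlam]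
  · simp only [hcard, hμ]

end MaxIntersectionTriple

section AltEdges

variable {V : Type*} [DecidableEq V] {A B : Finset (Sym2 V)}

lemma altEdges_comm {l : List (Sym2 V)} : AltEdges A B l ↔ AltEdges B A l := or_comm

lemma altEdges_iff_isChain {l : List (Sym2 V)} :
    AltEdges A B l ↔
      (∀ e ∈ l, e ∈ A \ B ∨ e ∈ B \ A) ∧ l.IsChain (fun e f => e ∈ A ↔ f ∉ A) := by
  constructor
  · intro h
    refine ⟨?_, ?_⟩
    · intro e he
      obtain ⟨i, hi, rfl⟩ := List.getElem_of_mem he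
      rcases h with h | h
      all_goals
        have := h i hi
        simp only [List.get_eq_getElem] at this
        split_ifs at this <;> tauto
    · rw [List.isChain_iff_getElem]
      intro i hi
      rcases h with h | h
      all_goals
        have h₁ := h i (by omega)
        have h₂ := h (i + 1) hi
        simp only [List.get_eq_getElem, Nat.even_add_one, mem_sdiff] at h₁ h₂
        split_ifs at h₁ h₂ <;> tauto
  · rintro ⟨hl, hc⟩
    rw [List.isChain_iff_getElem] at hc
    have key : ∀ i (h : i < l.length), l[i] ∈ A ↔ (Even i ↔ l[0] ∈ A) := by
      intro i
      induction i with
      | zero => simp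
      | succ i ih =>
        intro h
        have h₁ := ih (by omega)
        have h₂ := hc i h
        rw [Nat.even_add_one]
        tauto
    by_cases h0 : ∃ h : 0 < l.length, l[0] ∈ A
    · obtain ⟨_, h0⟩ := h0
      refine Or.inl fun i h => ?_
      have h₁ := key i h
      have h₂ := hl l[i] (List.getElem_mem h)
      simp only [List.get_eq_getElem, mem_sdiff] at *
      split_ifs <;> tauto
    · refine Or.inr fun i h => ?_
      have h₁ := key i h
      have h₂ := hl l[i] (List.getElem_mem h)
      have h₃ : l[0] ∉ A := fun h' => h0 ⟨by omega, h'⟩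
      simp only [List.get_eq_getElem, mem_sdiff] at *
      split_ifs <;> tauto

lemma AltEdges.reverse {l : List (Sym2 V)} (h : AltEdges A B l) : AltEdges A B l.reverse := by
  rw [altEdges_iff_isChain] at *
  refine ⟨by simpa using h.1, ?_⟩
  rw [List.isChain_reverse]
  exact h.2.imp fun e f hef => by tauto

lemma AltEdges.cons {l : List (Sym2 V)} (h : AltEdges A B l) {g e : Sym2 V}
    (he : l.head? = some e) (heA : e ∉ A) (hg : g ∈ A \ B) : AltEdges A B (g :: l) := by
  rw [altEdges_iff_isChain] at *
  refine ⟨by simpa using ⟨Or.inl (by simpa using hg), by simpa using h.1⟩, ?_⟩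
  rw [List.isChain_cons]
  refine ⟨?_, h.2⟩
  simp only [he, Option.mem_some_iff, forall_eq']
  simp [heA, (mem_sdiff.1 hg).1]

/-- The excess of edges in `B` over edges in `A` in an alternating list, twice, is determined by
the end edges. -/
lemma AltEdges.card_inter {l : List (Sym2 V)} (h : AltEdges A B l) (hl : l.Nodup)
    {e f : Sym2 V} (he : l.head? = some e) (hf : l.getLast? = some f) :
    2 * (((l.toFinset ∩ B).card : ℤ) - (l.toFinset ∩ A).card) =
      (if e ∈ A then -1 else 1) + (if f ∈ A then -1 else 1) := by
  rw [altEdges_iff_isChain] at h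
  obtain ⟨hAB, hc⟩ := h
  induction l generalizing e with
  | nil => simp at he
  | cons a l ih =>
    obtain rfl : a = e := by simpa using he
    have haB : a ∈ B ↔ a ∉ A := by
      have := hAB a (by simp)
      simp only [mem_sdiff] at this
      tauto
    have hstep : (((a :: l).toFinset ∩ B).card : ℤ) - ((a :: l).toFinset ∩ A).card =
        (((l.toFinset ∩ B).card : ℤ) - (l.toFinset ∩ A).card) + (if a ∈ A then -1 else 1) := by
      have hal : a ∉ l := (List.nodup_cons.1 hl).1
      by_cases ha : a ∈ A
      · rw [List.toFinset_cons, insert_inter_of_notMem (by tauto), insert_inter_of_mem ha,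
          card_insert_of_notMem (by simp [hal])]
        simp [ha]
        ring
      · rw [List.toFinset_cons, insert_inter_of_notMem ha, insert_inter_of_mem (by tauto),
          card_insert_of_notMem (by simp [hal])]
        simp [ha]
        ring
    rw [hstep]
    cases l with
    | nil =>
      obtain rfl : a = f := by simpa using hf
      split_ifs <;> simp
    | cons b l =>
      have hih := ih (List.nodup_cons.1 hl).2 (e := b) rfl (by simpa using hf)
        (fun x hx => hAB x (List.mem_cons_of_mem _ hx)) (List.isChain_cons_cons.1 hc).2
      have hab := (List.isChain_cons_cons.1 hc).1
      rw [mul_add, hih]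
      by_cases hb : b ∈ A
      · have : a ∉ A := by tauto
        simp only [hb, this, if_true, if_false]
        ring
      · have : a ∈ A := by tauto
        simp only [hb, this, if_true, if_false]
        ring

end AltEdges

namespace SimpleGraph.Walk

variable {V : Type*} {G : SimpleGraph V} {u v : V}

lemma start_mem_of_head?_edges {p : G.Walk u v} {e : Sym2 V} (he : p.edges.head? = some e) :
    u ∈ e := by
  cases p with
  | nil => simp at he
  | cons h q =>
    simp only [edges_cons, List.head?_cons, Option.some.injEq] at he
    simp [← he]

lemma end_mem_of_getLast?_edges {p : G.Walk u v} {e : Sym2 V} (he : p.edges.getLast? = some e) :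
    v ∈ e :=
  start_mem_of_head?_edges (p := p.reverse) (by simpa using he)

lemma IsPath.eq_of_start_mem {p : G.Walk u v} (hp : p.IsPath) {e g : Sym2 V}
    (he : p.edges.head? = some e) (hg : g ∈ p.edges) (hu : u ∈ g) : g = e := by
  cases p with
  | nil => simp at he
  | cons h q =>
    simp only [edges_cons, List.head?_cons, Option.some.injEq, List.mem_cons] at he hg
    rcases hg with hg | hg
    · exact hg.trans he
    · exact absurd (q.mem_support_of_mem_edges hg hu) (cons_isPath_iff h q |>.1 hp).2

/-- Every inner vertex of a walk whose edges alternate between `A` and its complement is incident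
to an edge of the walk in `A`. -/
lemma exists_mem_edges_of_isChain {A : Finset (Sym2 V)} (p : G.Walk u v)
    (hc : p.edges.IsChain (fun e f => e ∈ A ↔ f ∉ A)) {x : V} (hx : x ∈ p.support)
    (hxu : x ≠ u) (hxv : x ≠ v) : ∃ a ∈ p.edges, a ∈ A ∧ x ∈ a := by
  induction p with
  | nil => simp at hx; exact absurd hx hxu
  | @cons u w v h q ih =>
    by_cases hxw : x = w
    · subst hxw
      cases q with
      | nil => exact absurd rfl hxv
      | @cons _ y _ h' q' =>
        simp only [edges_cons, List.isChain_cons_cons] at hc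
        by_cases hA : s(u, x) ∈ A
        · exact ⟨s(u, x), by simp, hA, by simp⟩
        · exact ⟨s(x, y), by simp, by tauto, by simp⟩
    · rw [support_cons, List.mem_cons] at hx
      rw [edges_cons] at hc
      obtain ⟨a, ha, hA, hxa⟩ := ih hc.tail (hx.resolve_left hxu) hxw hxv
      exact ⟨a, by simp [ha], hA, hxa⟩

end SimpleGraph.Walk

namespace IsMaxAltPath

variable {V : Type*} [DecidableEq V] {G : SimpleGraph V} {A B : Finset (Sym2 V)} {u v : V}
  {p : G.Walk u v}

lemma comm (hp : IsMaxAltPath G A B p) : IsMaxAltPath G B A p := by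
  unfold IsMaxAltPath at *
  simpa only [altEdges_comm (A := B)] using hp

lemma reverse (hp : IsMaxAltPath G A B p) : IsMaxAltPath G A B p.reverse := by
  refine ⟨hp.1.reverse, ?_, ?_⟩
  · rw [SimpleGraph.Walk.edges_reverse]
    exact hp.2.1.reverse
  · simpa [SimpleGraph.Walk.edges_reverse] using hp.2.2

/-- An edge of `A` at the start of a maximal alternating path starting with an edge outside `A`
closes the path to an alternating cycle. -/
lemma eq_of_start_mem (hp : IsMaxAltPath G A B p) (hA : IsMatchingSet G A)
    (hB : IsMatchingSet G B) {e f g : Sym2 V} (he : p.edges.head? = some e)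
    (hf : p.edges.getLast? = some f) (heA : e ∉ A) (hg : g ∈ A) (hu : u ∈ g) :
    g = s(u, v) ∧ f ∉ A := by
  obtain ⟨hpath, halt, hmax⟩ := hp
  obtain ⟨hAB, hc⟩ := altEdges_iff_isChain.1 halt
  have hue := SimpleGraph.Walk.start_mem_of_head?_edges he
  have hgp : g ∉ p.edges := fun h => heA (hpath.eq_of_start_mem he h hu ▸ hg)
  have heB : e ∈ B := by
    have := hAB e (List.mem_of_head? he)
    simp only [mem_sdiff] at this
    tauto
  have hgB : g ∉ B := fun h => heA (hB.eq_of_mem h heB hu hue ▸ hg)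
  obtain ⟨y, rfl⟩ := hu
  have hadj : G.Adj u y := hA.1 hg
  have hy : y ∈ p.support := by
    by_contra hy
    refine hmax ⟨y, v, .cons hadj.symm p, hpath.cons hy, ?_, by simp +contextual, by simp⟩
    rw [SimpleGraph.Walk.edges_cons, Sym2.eq_swap]
    exact halt.cons he heA (by simp [hg, hgB])
  obtain rfl : y = v := by
    by_contra hyv
    obtain ⟨a, ha, haA, hya⟩ := p.exists_mem_edges_of_isChain hc hy hadj.ne' hyv
    exact hgp (hA.eq_of_mem haA hg hya (by simp) ▸ ha)
  refine ⟨rfl, fun hfA => hgp ?_⟩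
  rw [← hA.eq_of_mem hfA hg (SimpleGraph.Walk.end_mem_of_getLast?_edges hf) (by simp)]
  exact List.mem_of_getLast? hf

/-- The edges of `A` meeting a maximal alternating path lie on it, except possibly the one
joining its ends. -/
lemma mem_edges_or_eq (hp : IsMaxAltPath G A B p) (hA : IsMatchingSet G A)
    (hB : IsMatchingSet G B) {e f g : Sym2 V} (he : p.edges.head? = some e)
    (hf : p.edges.getLast? = some f) {x : V} (hx : x ∈ p.support) (hg : g ∈ A) (hxg : x ∈ g) :
    g ∈ p.edges ∨ (g = s(u, v) ∧ e ∉ A ∧ f ∉ A) := by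
  by_cases hxu : x = u
  · subst hxu
    by_cases heA : e ∈ A
    · rw [hA.eq_of_mem hg heA hxg (SimpleGraph.Walk.start_mem_of_head?_edges he)]
      exact Or.inl (List.mem_of_head? he)
    · have := hp.eq_of_start_mem hA hB he hf heA hg hxg
      exact Or.inr ⟨this.1, heA, this.2⟩
  by_cases hxv : x = v
  · subst hxv
    by_cases hfA : f ∈ A
    · rw [hA.eq_of_mem hg hfA hxg (SimpleGraph.Walk.end_mem_of_getLast?_edges hf)]
      exact Or.inl (List.mem_of_getLast? hf)
    · have := hp.reverse.eq_of_start_mem hA hB (by simpa using hf) (by simpa using he) hfA hg hxg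
      exact Or.inr ⟨this.1.trans Sym2.eq_swap, this.2, hfA⟩
  obtain ⟨a, ha, haA, hxa⟩ :=
    p.exists_mem_edges_of_isChain (altEdges_iff_isChain.1 hp.2.1).2 hx hxu hxv
  exact Or.inl (hA.eq_of_mem haA hg hxa hxg ▸ ha)

end IsMaxAltPath

namespace MaxIntersectionTriple

variable {V : Type*} [Fintype V] [DecidableEq V] {G : SimpleGraph V} {M H H' : Finset (Sym2 V)}
  {u v : V} {p : G.Walk u v} {e f : Sym2 V}

/-- Both end edges of a maximal `M,H`-alternating path belong to `M`. -/
lemma head_mem_and_getLast_mem (ht : MaxIntersectionTriple G M H H') (hp : IsMaxAltPath G M H p)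
    (he : p.edges.head? = some e) (hf : p.edges.getLast? = some f) : e ∈ M ∧ f ∈ M := by
  by_contra hef
  have hM := ht.isMatchingSet_left
  have hH := ht.isMatchingSet_right
  obtain ⟨hAB, -⟩ := altEdges_iff_isChain.1 hp.2.1
  have hcard := hp.2.1.card_inter hp.1.isTrail.edges_nodup he hf
  have hclosed : ∀ a ∈ p.edges, ∀ x ∈ a, ∀ g ∈ M, x ∈ g →
      g ∈ p.edges ∨ (g = s(u, v) ∧ e ∉ M ∧ f ∉ M) := fun a ha x hxa g hg hxg =>
    hp.mem_edges_or_eq hM hH he hf (p.mem_support_of_mem_edges ha hxa) hg hxg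
  have hne : ∃ a ∈ p.edges, a ∈ H := by
    rw [not_and_or] at hef
    rcases hef with h | h
    · refine ⟨e, List.mem_of_head? he, ?_⟩
      have := hAB e (List.mem_of_head? he)
      simp only [mem_sdiff] at this
      tauto
    · refine ⟨f, List.mem_of_getLast? hf, ?_⟩
      have := hAB f (List.mem_of_getLast? hf)
      simp only [mem_sdiff] at this
      tauto
  by_cases hg : s(u, v) ∈ M ∧ s(u, v) ∉ p.edges ∧ e ∉ M ∧ f ∉ M
  · obtain ⟨hgM, hgp, heM, hfM⟩ := hg
    have hgH : s(u, v) ∉ H := by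
      intro hgH
      have heH : e ∈ H := by
        have := hAB e (List.mem_of_head? he)
        simp only [mem_sdiff] at this
        tauto
      have := hH.eq_of_mem hgH heH (x := u) (by simp)
        (SimpleGraph.Walk.start_mem_of_head?_edges he)
      exact heM (this ▸ hgM)
    refine ht.not_flip (P := insert s(u, v) p.edges.toFinset) ?_ ?_ ?_ ?_
    · intro a ha
      rw [mem_insert, List.mem_toFinset] at ha
      rcases ha with rfl | ha
      · exact Or.inl (mem_sdiff.2 ⟨hgM, hgH⟩)
      · exact hAB a ha
    · intro a ha haM x hxa b hb hxb
      rw [mem_insert, List.mem_toFinset] at ha ⊢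
      have := hclosed a (ha.resolve_left fun h => haM (h ▸ hgM)) x hxa b hb hxb
      tauto
    · rw [insert_inter_of_mem hgM, insert_inter_of_notMem hgH,
        card_insert_of_notMem (by simp [hgp])]
      simp only [heM, hfM, if_false] at hcard
      omega
    · obtain ⟨a, ha, haH⟩ := hne
      exact ⟨a, by simp [ha], haH⟩
  · refine ht.not_flip (P := p.edges.toFinset) ?_ ?_ ?_ ?_
    · simpa using hAB
    · intro a ha haM x hxa b hb hxb
      rw [List.mem_toFinset] at ha ⊢
      rcases hclosed a ha x hxa b hb hxb with h | ⟨rfl, h⟩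
      · exact h
      · by_contra hbp
        exact hg ⟨hb, hbp, h⟩
    · split_ifs at hcard with h₁ h₂
      · exact absurd ⟨h₁, h₂⟩ hef
      all_goals omega
    · simpa using hne

/-- A maximal alternating path does not start at a vertex saturated by `H`. -/
lemma notMem_of_start_mem (ht : MaxIntersectionTriple G M H H') (hp : IsMaxAltPath G M H p)
    (he : p.edges.head? = some e) (hf : p.edges.getLast? = some f) {g : Sym2 V} (hu : u ∈ g) :
    g ∉ H := by
  intro hg
  have hM := ht.isMatchingSet_left
  have hH := ht.isMatchingSet_right
  obtain ⟨heM, hfM⟩ := ht.head_mem_and_getLast_mem hp he hf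
  obtain ⟨hAB, -⟩ := altEdges_iff_isChain.1 hp.2.1
  have hcard := hp.2.1.card_inter hp.1.isTrail.edges_nodup he hf
  have heH : e ∉ H := by
    have := hAB e (List.mem_of_head? he)
    simp only [mem_sdiff] at this
    tauto
  obtain ⟨rfl, -⟩ := hp.comm.eq_of_start_mem hH hM he hf heH hg hu
  have hue := SimpleGraph.Walk.start_mem_of_head?_edges he
  have hgM : s(u, v) ∉ M := fun h => heH (hM.eq_of_mem h heM hu hue ▸ hg)
  have hgp : s(u, v) ∉ p.edges := fun h => heH (hp.1.eq_of_start_mem he h hu ▸ hg)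
  refine ht.not_flip (P := insert s(u, v) p.edges.toFinset) ?_ ?_ ?_ ⟨_, mem_insert_self _ _, hg⟩
  · intro a ha
    rw [mem_insert, List.mem_toFinset] at ha
    rcases ha with rfl | ha
    · exact Or.inr (mem_sdiff.2 ⟨hg, hgM⟩)
    · exact hAB a ha
  · intro a ha _ x hxa b hb hxb
    rw [mem_insert, List.mem_toFinset] at ha ⊢
    have hx : x ∈ p.support := by
      rcases ha with rfl | ha
      · rcases Sym2.mem_iff.1 hxa with rfl | rfl <;> simp
      · exact p.mem_support_of_mem_edges ha hxa
    have := hp.mem_edges_or_eq hM hH he hf hx hb hxb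
    tauto
  · rw [insert_inter_of_mem hg, insert_inter_of_notMem hgM, card_insert_of_notMem (by simp [hgp])]
    simp only [heM, hfM, if_true] at hcard
    omega

lemma head_mem (ht : MaxIntersectionTriple G M H H') (hp : IsMaxAltPath G M H p)
    (hlen : 2 ≤ p.edges.length) (he : p.edges.head? = some e) : e ∈ H' := by
  obtain ⟨f, hf⟩ : ∃ f, p.edges.getLast? = some f :=
    ⟨_, List.getLast?_eq_some_getLast (by rintro h; simp [h] at hlen)⟩
  have hstart : ∀ g, u ∈ g → g ∉ H := fun g => ht.notMem_of_start_mem hp he hf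
  have heM := (ht.head_mem_and_getLast_mem hp he hf).1
  obtain ⟨hAB, hc⟩ := altEdges_iff_isChain.1 hp.2.1
  match p with
  | .nil => simp at hlen
  | .cons _ .nil => simp at hlen
  | .cons (v := w) h (.cons (v := y) h' q) =>
    simp only [SimpleGraph.Walk.edges_cons, List.head?_cons, Option.some.injEq] at he
    subst he
    simp only [SimpleGraph.Walk.edges_cons, List.isChain_cons_cons] at hc
    have hfM : s(w, y) ∉ M := hc.1.1 heM
    have hfH : s(w, y) ∈ H := by
      have := hAB s(w, y) (by simp)
      simp only [mem_sdiff] at this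
      tauto
    refine ht.mem_of_unique_neighbor heM (hstart _ (by simp)) hfH hfM ?_
    intro g hg x hx hxg
    rcases Sym2.mem_iff.1 hx with rfl | rfl
    · exact absurd hg (hstart g hxg)
    · exact ht.isMatchingSet_right.eq_of_mem hg hfH hxg (by simp)

end MaxIntersectionTriple

/-- For a maximum intersection triple with μ(G) < ν(G), the end edges of every
maximal M,H-alternating path of length at least 2 belong to H'. -/
theorem stmt14 {V : Type*} [Fintype V] [DecidableEq V] (G : SimpleGraph V)
    (hratio : muG G < nuG G) (M H H' : Finset (Sym2 V))
    (ht : MaxIntersectionTriple G M H H')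
    (u v : V) (p : G.Walk u v) (hp : IsMaxAltPath G M H p)
    (hlen : 2 ≤ p.edges.length) :
    ∃ e₁ e₂ : Sym2 V, p.edges.head? = some e₁ ∧ p.edges.getLast? = some e₂ ∧
      e₁ ∈ H' ∧ e₂ ∈ H' := by
  have hne : p.edges ≠ [] := by
    intro h
    simp [h] at hlen
  refine ⟨_, _, List.head?_eq_some_head hne, List.getLast?_eq_some_getLast hne, ?_, ?_⟩
  · exact ht.head_mem hp hlen (List.head?_eq_some_head hne)
  · refine ht.head_mem hp.reverse (by simpa using hlen) ?_
    rw [SimpleGraph.Walk.edges_reverse, List.head?_reverse]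
    exact List.getLast?_eq_some_getLast hne
end

section
/- Let G be a finite simple graph with μ(G) < ν(G), let (M, H, H') be a maximum intersection triple in G, and let P be a maximal M,H-alternating path in G of length at least 2. Then every interior vertex of P (a vertex of P other than its two endpoints) is incident to some edge of H'. -/
open Finset

/-- In a finite graph, disjoint matchings have total size at most `lamG G`. -/
theorem card_add_card_le_lamG {V : Type*} [Fintype V] {G : SimpleGraph V}
    {H H' : Finset (Sym2 V)} (hH : IsMatchingSet G H) (hH' : IsMatchingSet G H')
    (hd : Disjoint H H') : H.card + H'.card ≤ lamG G := by
  classical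
  refine le_csSup ⟨Fintype.card (Sym2 V) + Fintype.card (Sym2 V), ?_⟩ ⟨H, H', hH, hH', hd, rfl⟩
  rintro n ⟨A, B, -, -, -, rfl⟩
  exact Nat.add_le_add A.card_le_univ B.card_le_univ

theorem IsMatchingSet.mono {V : Type*} {G : SimpleGraph V} {A B : Finset (Sym2 V)}
    (hB : IsMatchingSet G B) (h : A ⊆ B) : IsMatchingSet G A :=
  ⟨fun _ he => hB.1 (h he), fun e he f hf => hB.2 e (h he) f (h hf)⟩

theorem IsMatchingSet.insert {V : Type*} [DecidableEq V] {G : SimpleGraph V}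
    {A : Finset (Sym2 V)} (hA : IsMatchingSet G A) {e : Sym2 V} (he : e ∈ G.edgeSet)
    (h : ∀ x ∈ e, ¬ Saturates A x) : IsMatchingSet G (insert e A) := by
  refine ⟨?_, ?_⟩
  · intro f hf
    rcases Finset.mem_insert.1 hf with rfl | hf
    exacts [he, hA.1 hf]
  · intro f hf g hg hne x hxf hxg
    rw [Finset.mem_insert] at hf hg
    rcases hf with rfl | hf <;> rcases hg with rfl | hg
    · exact hne rfl
    · exact h x hxf ⟨g, hg, hxg⟩
    · exact h x hxg ⟨f, hf, hxf⟩
    · exact hA.2 f hf g hg hne x hxf hxg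

/-- In a maximum intersection triple, every vertex covered by `M \ H` is covered by `H'`:
otherwise its edge could be added to `H'`, possibly in exchange for one edge outside `M`. -/
theorem MaxIntersectionTriple.saturates {V : Type*} [Fintype V] [DecidableEq V]
    {G : SimpleGraph V} {M H H' : Finset (Sym2 V)} (ht : MaxIntersectionTriple G M H H')
    {e : Sym2 V} (he : e ∈ M \ H) {w : V} (hw : w ∈ e) : Saturates H' w := by
  by_contra hns
  obtain ⟨hM, hMcard, ⟨⟨hH, hH', hd, hcard⟩, hmu⟩, hmax, -⟩ := ht
  dsimp only at hH hH' hd hcard hmu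
  obtain ⟨heM, heH⟩ := Finset.mem_sdiff.1 he
  have heH' : e ∉ H' := fun h => hns ⟨e, h, hw⟩
  obtain ⟨x, rfl⟩ := hw
  by_cases hx : Saturates H' x
  · obtain ⟨f, hf, hxf⟩ := hx
    have hfM : f ∉ M := fun h =>
      hM.2 s(w, x) heM f h (fun h' => heH' (h' ▸ hf)) x (Sym2.mem_mk_right w x) hxf
    have hins : IsMatchingSet G (insert s(w, x) (H'.erase f)) := by
      refine (hH'.mono (Finset.erase_subset f H')).insert (hM.1 heM) ?_
      rintro y hy ⟨g, hg, hyg⟩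
      obtain ⟨hgf, hg⟩ := Finset.mem_erase.1 hg
      rcases Sym2.mem_iff.1 hy with rfl | rfl
      · exact hns ⟨g, hg, hyg⟩
      · exact hH'.2 g hg f hf hgf y hyg hxf
    have hdisj : Disjoint H (insert s(w, x) (H'.erase f)) :=
      Finset.disjoint_insert_right.2 ⟨heH, hd.mono_right (Finset.erase_subset f H')⟩
    have hins_card : (insert s(w, x) (H'.erase f)).card = H'.card := by
      rw [Finset.card_insert_of_notMem fun h => heH' (Finset.mem_of_mem_erase h),
        Finset.card_erase_add_one hf]
    have hle := hmax M H (insert s(w, x) (H'.erase f)) hM hMcard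
      ⟨⟨hH, hins, hdisj, by simpa [hins_card] using hcard⟩, hmu⟩
    refine hle.not_gt (Finset.card_lt_card (Finset.ssubset_iff.2 ⟨s(w, x), by simp [heH, heH'], ?_⟩))
    intro g hg
    have hgf : g ∈ M → g ≠ f := fun h h' => hfM (h' ▸ h)
    simp only [Finset.mem_insert, Finset.mem_inter, Finset.mem_union, Finset.mem_erase] at hg ⊢
    grind
  · have hins : IsMatchingSet G (insert s(w, x) H') := by
      refine hH'.insert (hM.1 heM) fun y hy => ?_
      rcases Sym2.mem_iff.1 hy with rfl | rfl
      exacts [hns, hx]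
    have := card_add_card_le_lamG hH hins (Finset.disjoint_insert_right.2 ⟨heH, hd⟩)
    rw [Finset.card_insert_of_notMem heH'] at this
    omega

/-- Of two consecutive edges of an `A`,`B`-alternating list, one lies in `A \ B`. -/
theorem AltEdges.mem_sdiff_or {V : Type*} [DecidableEq V] {A B : Finset (Sym2 V)}
    {l : List (Sym2 V)} (h : AltEdges A B l) {i : ℕ} (hi : i + 1 < l.length) :
    l[i] ∈ A \ B ∨ l[i + 1] ∈ A \ B := by
  rcases h with h | h <;>
  · have h₁ := h i (by omega)
    have h₂ := h (i + 1) hi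
    simp only [Nat.even_add_one, List.get_eq_getElem] at h₁ h₂
    by_cases hp : Even i <;> simp_all

/-- For a maximum intersection triple with μ(G) < ν(G), every interior vertex of a
maximal M,H-alternating path of length at least 2 is incident to an edge of H'. -/
theorem stmt15 {V : Type*} [Fintype V] [DecidableEq V] (G : SimpleGraph V)
    (hratio : muG G < nuG G) (M H H' : Finset (Sym2 V))
    (ht : MaxIntersectionTriple G M H H')
    (u v : V) (p : G.Walk u v) (hp : IsMaxAltPath G M H p)
    (hlen : 2 ≤ p.edges.length) :
    ∀ w ∈ p.support, w ≠ u → w ≠ v → Saturates H' w := by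
  intro w hw hwu hwv
  obtain ⟨n, rfl, hn⟩ := SimpleGraph.Walk.mem_support_iff_exists_getVert.1 hw
  obtain ⟨i, rfl⟩ : ∃ i, n = i + 1 :=
    Nat.exists_eq_succ_of_ne_zero fun h => hwu (by rw [h, p.getVert_zero])
  have hlt : i + 1 < p.edges.length := by
    rw [p.length_edges]
    exact lt_of_le_of_ne hn fun h => hwv (by rw [h, p.getVert_length])
  rcases hp.2.1.mem_sdiff_or hlt with h | h
  · exact ht.saturates h (by simp [SimpleGraph.Walk.getElem_edges])
  · exact ht.saturates h (by simp [SimpleGraph.Walk.getElem_edges])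
end
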